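/- Let m ≥ 3 and 1 ≤ r ≤ s ≤ m−2 be integers, let L = {(0,…,0,x_{s+1},…,x_m) : x_i ∈ 𝔽₂} ⊆ 𝔽₂^m (first s coordinates zero), and let π : 𝔽₂^m → 𝔽₂^m be the permutation π(x₁,…,x_m) = (x₁ + ∏_{i=r+1}^{m} x_i, x₂,…,x_m). Then f_{(π,L)} : 𝔽₂^{2m} → 𝔽₂ is not a bent function. -/

import Mathlib

/-- Dot product on `𝔽₂^m`. -/
def dotp {m : ℕ} (x y : Fin m → ZMod 2) : ZMod 2 := ∑ i, x i * y i

/-- `f : 𝔽₂^m × 𝔽₂^m → 𝔽₂` is bent: every Walsh–Hadamard coefficient is `±2^m`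
(the dimension is `t = 2m`, so `2^{t/2} = 2^m`). -/
def IsBent2m {m : ℕ} (f : (Fin m → ZMod 2) × (Fin m → ZMod 2) → ZMod 2) : Prop :=
  ∀ a : (Fin m → ZMod 2) × (Fin m → ZMod 2),
    (∑ z : (Fin m → ZMod 2) × (Fin m → ZMod 2),
        (-1 : ℤ) ^ ((f z + dotp a.1 z.1 + dotp a.2 z.2).val)) = 2 ^ m ∨
    (∑ z : (Fin m → ZMod 2) × (Fin m → ZMod 2),
        (-1 : ℤ) ^ ((f z + dotp a.1 z.1 + dotp a.2 z.2).val)) = -2 ^ m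

/-- Carlet's function `f_{(π,L)}(x,y) = x·π(y) + 1_{L^⊥}(x)`. -/
noncomputable def fpl {m : ℕ} (π : (Fin m → ZMod 2) → (Fin m → ZMod 2))
    (L : Set (Fin m → ZMod 2)) (z : (Fin m → ZMod 2) × (Fin m → ZMod 2)) : ZMod 2 :=
  dotp z.1 (π z.2) +
    ({y : Fin m → ZMod 2 | ∀ x ∈ L, dotp x y = 0}).indicator (fun _ => 1) z.1

/-- The nontrivial additive character of `𝔽₂` with integer values. -/
def signChar (u : ZMod 2) : ℤ := (-1) ^ u.val

lemma signChar_add (u v : ZMod 2) : signChar (u + v) = signChar u * signChar v := by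
  revert u v; decide

lemma signChar_sum {ι : Type*} (t : Finset ι) (f : ι → ZMod 2) :
    signChar (∑ i ∈ t, f i) = ∏ i ∈ t, signChar (f i) := by
  classical
  induction t using Finset.induction_on with
  | empty => rfl
  | insert a t ha ih => rw [Finset.sum_insert ha, Finset.prod_insert ha, signChar_add, ih]

lemma sum_prod_pi {m : ℕ} (g : Fin m → ZMod 2 → ℤ) :
    ∑ x : Fin m → ZMod 2, ∏ i, g i (x i) = ∏ i, ∑ t, g i t := by
  rw [Finset.prod_univ_sum, Fintype.piFinset_univ]

lemma ite_forall_eq_prod {m : ℕ} (P : Fin m → Prop) [DecidablePred P] [Decidable (∀ i, P i)] :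
    (if ∀ i, P i then (1 : ℤ) else 0) = ∏ i, if P i then 1 else 0 := by
  rw [Fintype.prod_boole]
  congr

lemma card_filter_val_lt_of_le {m s : ℕ} (h : s ≤ m) :
    (Finset.univ.filter (fun i : Fin m => (i : ℕ) < s)).card = s := by
  rw [Fin.card_filter_val_lt, min_eq_right h]

lemma sum_signChar_dotp {m s : ℕ} (h : s ≤ m) (v : Fin m → ZMod 2) :
    ∑ x : Fin m → ZMod 2,
      (if ∀ i : Fin m, s ≤ (i : ℕ) → x i = 0 then 1 else 0) * signChar (dotp x v) =
    if ∀ i : Fin m, (i : ℕ) < s → v i = 0 then 2 ^ s else 0 := by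
  have factor : ∀ i : Fin m,
      ∑ t : ZMod 2, (if s ≤ (i : ℕ) → t = 0 then 1 else 0) * signChar (t * v i) =
        (if (i : ℕ) < s → v i = 0 then 1 else 0) * (if (i : ℕ) < s then 2 else 1) := by
    intro i
    generalize v i = w
    by_cases hi : (i : ℕ) < s
    · simp only [hi, not_le.mpr hi, false_imp_iff, true_imp_iff, if_true]
      revert w; decide
    · simp only [hi, not_lt.mp hi, false_imp_iff, true_imp_iff, if_true, if_false]
      revert w; decide
  simp only [dotp, signChar_sum, ite_forall_eq_prod, ← Finset.prod_mul_distrib]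
  rw [sum_prod_pi (fun i t => (if s ≤ (i : ℕ) → t = 0 then 1 else 0) * signChar (t * v i)),
    Finset.prod_congr rfl (fun i _ => factor i), Finset.prod_mul_distrib, Fintype.prod_boole,
    Finset.prod_ite, Finset.prod_const, Finset.prod_const_one, card_filter_val_lt_of_le h]
  split_ifs <;> simp

lemma sum_eq_on_prefix {m s : ℕ} (h : s ≤ m) (a : Fin m → ZMod 2) :
    ∑ z : Fin m → ZMod 2, (if ∀ i : Fin m, (i : ℕ) < s → z i = a i then (1 : ℤ) else 0) =
      2 ^ (m - s) := by
  have factor : ∀ i : Fin m,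
      ∑ t : ZMod 2, (if (i : ℕ) < s → t = a i then (1 : ℤ) else 0) =
        if (i : ℕ) < s then 1 else 2 := by
    intro i
    generalize a i = w
    by_cases hi : (i : ℕ) < s
    · simp [hi]
    · simp [hi]
  have hc : (Finset.univ.filter (fun i : Fin m => ¬ (i : ℕ) < s)).card = m - s := by
    have := Finset.card_filter_add_card_filter_not
      (s := (Finset.univ : Finset (Fin m))) (fun i => (i : ℕ) < s)
    rw [card_filter_val_lt_of_le h, Finset.card_univ, Fintype.card_fin] at this
    omega
  simp only [ite_forall_eq_prod]
  rw [sum_prod_pi (fun i t => if (i : ℕ) < s → t = a i then (1 : ℤ) else 0),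
    Finset.prod_congr rfl (fun i _ => factor i), Finset.prod_ite, Finset.prod_const_one,
    Finset.prod_const, hc, one_mul]

/-- The orthogonal of the vectors vanishing on the first `s` coordinates. -/
lemma forall_dotp_eq_zero_iff {m s : ℕ} (y : Fin m → ZMod 2) :
    (∀ x ∈ {x : Fin m → ZMod 2 | ∀ j : Fin m, (j : ℕ) < s → x j = 0}, dotp x y = 0) ↔
      ∀ i : Fin m, s ≤ (i : ℕ) → y i = 0 := by
  constructor
  · intro h i hi
    have := h (Pi.single i 1) fun j hj => Pi.single_eq_of_ne (by rintro rfl; omega) 1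
    simpa [dotp, Pi.single_apply] using this
  · intro h x hx
    refine Finset.sum_eq_zero fun i _ => ?_
    by_cases hi : (i : ℕ) < s
    · rw [hx i hi, zero_mul]
    · rw [h i (not_lt.mp hi), mul_zero]

lemma dotp_add_right {m : ℕ} (x u v : Fin m → ZMod 2) :
    dotp x (u + v) = dotp x u + dotp x v := by
  simp [dotp, mul_add, Finset.sum_add_distrib]

lemma dotp_comm {m : ℕ} (x y : Fin m → ZMod 2) : dotp x y = dotp y x := by
  simp [dotp, mul_comm]

lemma signChar_fpl {m s : ℕ} (π : (Fin m → ZMod 2) → (Fin m → ZMod 2))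
    (x y a : Fin m → ZMod 2) (c : ZMod 2) :
    signChar (fpl π {x : Fin m → ZMod 2 | ∀ j : Fin m, (j : ℕ) < s → x j = 0} (x, y) +
        dotp a x + c) =
      signChar c * (signChar (dotp x (π y + a)) -
        2 * ((if ∀ i : Fin m, s ≤ (i : ℕ) → x i = 0 then 1 else 0) *
          signChar (dotp x (π y + a)))) := by
  rw [fpl, dotp_comm a x, dotp_add_right]
  have hmem : x ∈ {y : Fin m → ZMod 2 | ∀ x ∈ {x : Fin m → ZMod 2 | ∀ j : Fin m,
      (j : ℕ) < s → x j = 0}, dotp x y = 0} ↔ ∀ i : Fin m, s ≤ (i : ℕ) → x i = 0 :=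
    forall_dotp_eq_zero_iff x
  simp only [Set.indicator_apply, hmem, signChar_add]
  have h1 : signChar 1 = -1 := rfl
  have h0 : signChar 0 = 1 := rfl
  split_ifs
  · rw [h1]; ring
  · rw [h0]; ring

lemma sum_signChar_fpl {m s : ℕ} (h : s ≤ m) (π : (Fin m → ZMod 2) → (Fin m → ZMod 2))
    (y a : Fin m → ZMod 2) (c : ZMod 2) :
    ∑ x, signChar (fpl π {x : Fin m → ZMod 2 | ∀ j : Fin m, (j : ℕ) < s → x j = 0} (x, y) +
        dotp a x + c) =
      signChar c * ((if π y = a then 2 ^ m else 0) -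
        2 * (2 ^ s * if ∀ i : Fin m, (i : ℕ) < s → π y i = a i then 1 else 0)) := by
  have add_eq_zero : ∀ u v : ZMod 2, u + v = 0 ↔ u = v := by decide
  have full := sum_signChar_dotp le_rfl (π y + a)
  have part := sum_signChar_dotp h (π y + a)
  simp only [Pi.add_apply, add_eq_zero] at full part
  have vac : ∀ x : Fin m → ZMod 2, (∀ i : Fin m, m ≤ (i : ℕ) → x i = 0) ↔ True :=
    fun x => iff_true_intro fun i hi => absurd i.isLt (not_lt.mpr hi)
  simp only [vac, if_true, one_mul, Fin.is_lt, true_imp_iff] at full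
  simp only [signChar_fpl]
  rw [← Finset.mul_sum, Finset.sum_sub_distrib, ← Finset.mul_sum, full, part]
  simp only [funext_iff, mul_ite, mul_one, mul_zero]

/-- for `m ≥ 3`, `1 ≤ r ≤ s ≤ m−2`, with
`L = {(0,…,0,x_{s+1},…,x_m)}` and `π(x) = (x₁ + ∏_{i=r+1}^m x_i, x₂,…,x_m)`,
the function `f_{(π,L)}` is not bent. (Coordinates are 0-indexed: `x j` is `x_{j+1}`,
so `x_i` for `i ≥ r+1` has index `≥ r`.) -/
theorem stmt_10 (m r s : ℕ) [NeZero m] (hm : 3 ≤ m) (hr : 1 ≤ r) (hrs : r ≤ s)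
    (hsm : s ≤ m - 2) :
    ¬ IsBent2m (fpl
      (fun x : Fin m → ZMod 2 => Function.update x 0
        (x 0 + ∏ i ∈ Finset.univ.filter (fun i : Fin m => r ≤ (i : ℕ)), x i))
      {x : Fin m → ZMod 2 | ∀ j : Fin m, (j : ℕ) < s → x j = 0}) := by
  intro hbent
  set π : (Fin m → ZMod 2) → (Fin m → ZMod 2) := fun x => Function.update x 0
    (x 0 + ∏ i ∈ Finset.univ.filter (fun i : Fin m => r ≤ (i : ℕ)), x i) with hπ
  have hsm' : s ≤ m := by omega
  have π_zero : ∀ x, π x 0 =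
      x 0 + ∏ i ∈ Finset.univ.filter (fun i : Fin m => r ≤ (i : ℕ)), x i := by
    intro x; simp [hπ]
  have π_ne : ∀ x i, i ≠ 0 → π x i = x i := by
    intro x i hi; simp [hπ, hi]
  have π_invol : Function.Involutive π := by
    intro x
    have hprod : ∏ i ∈ Finset.univ.filter (fun i : Fin m => r ≤ (i : ℕ)), π x i =
        ∏ i ∈ Finset.univ.filter (fun i : Fin m => r ≤ (i : ℕ)), x i := by
      refine Finset.prod_congr rfl fun i hi => π_ne x i ?_
      rintro rfl
      simp at hi
      omega
    funext i
    by_cases hi : i = 0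
    · subst hi
      rw [π_zero, hprod, π_zero, add_assoc, CharTwo.add_self_eq_zero, add_zero]
    · rw [π_ne _ _ hi, π_ne _ _ hi]
  let a : Fin m → ZMod 2 := fun i => if r ≤ (i : ℕ) ∧ (i : ℕ) < s then 1 else 0
  let w : Fin m → ZMod 2 := fun i => if r ≤ (i : ℕ) then 1 else 0
  have hmem : ∀ z : Fin m → ZMod 2, (∀ i : Fin m, (i : ℕ) < s → z i = a i) →
      signChar (π z 0) = 1 - 2 * if z = w then 1 else 0 := by
    intro z hz
    have h0 : z 0 = 0 := by
      rw [hz 0 (by simp; omega)]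
      simp [a]
      omega
    rw [π_zero, h0, zero_add]
    by_cases hzw : z = w
    · rw [if_pos hzw, Finset.prod_eq_one]
      · rfl
      · intro i hi
        rw [hzw]
        exact if_pos (Finset.mem_filter.mp hi).2
    · rw [if_neg hzw]
      obtain ⟨i, hi⟩ := Function.ne_iff.mp hzw
      have hri : r ≤ (i : ℕ) := by
        by_contra hlt
        apply hi
        rw [hz i (by omega)]
        simp [a, w, hlt]
      have hi0 : z i = 0 := by
        have two : ∀ u : ZMod 2, u ≠ 1 → u = 0 := by decide
        exact two _ (by simpa [w, hri] using hi)
      rw [Finset.prod_eq_zero (Finset.mem_filter.mpr ⟨Finset.mem_univ i, hri⟩) hi0]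
      rfl
  have hw : ∀ i : Fin m, (i : ℕ) < s → w i = a i := by
    intro i hi
    simp [a, w, hi]
  have ha : signChar (π a 0) = 1 := by
    rw [hmem a fun _ _ => rfl, if_neg]
    · rfl
    · intro haw
      have := congrFun haw ⟨m - 1, by omega⟩
      simp only [a, w] at this
      rw [if_neg (by omega), if_pos (by omega)] at this
      exact zero_ne_one this
  have key : ∑ z : (Fin m → ZMod 2) × (Fin m → ZMod 2),
      (-1 : ℤ) ^ ((fpl π {x : Fin m → ZMod 2 | ∀ j : Fin m, (j : ℕ) < s → x j = 0} z +
        dotp a z.1 + dotp (Pi.single 0 1) z.2).val) =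
      2 ^ m - 2 * (2 ^ s * (2 ^ (m - s) - 2)) := by
    change ∑ z : (Fin m → ZMod 2) × (Fin m → ZMod 2), signChar _ = _
    have hdot : ∀ y : Fin m → ZMod 2, dotp (Pi.single 0 1) y = y 0 := by
      intro y; simp [dotp, Pi.single_apply]
    rw [Fintype.sum_prod_type_right]
    simp only [hdot, sum_signChar_fpl hsm']
    rw [← Equiv.sum_comp π_invol.toPerm]
    simp only [Function.Involutive.coe_toPerm, π_invol _]
    have term : ∀ z : Fin m → ZMod 2,
        signChar (π z 0) * ((if z = a then 2 ^ m else 0) -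
          2 * (2 ^ s * if ∀ i : Fin m, (i : ℕ) < s → z i = a i then 1 else 0)) =
        (if z = a then 2 ^ m else 0) -
          2 * (2 ^ s * ((if ∀ i : Fin m, (i : ℕ) < s → z i = a i then 1 else 0) -
            2 * if z = w then 1 else 0)) := by
      intro z
      by_cases hz : ∀ i : Fin m, (i : ℕ) < s → z i = a i
      · by_cases hza : z = a
        · have := hmem z hz
          rw [hza, ha] at this
          simp only [hza, ha, if_true, implies_true]
          linear_combination (-2 * 2 ^ s) * this
        · rw [hmem z hz, if_neg hza, if_pos hz]
          ring
      · have hza : z ≠ a := by rintro rfl; exact hz fun _ _ => rfl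
        have hzw : z ≠ w := by rintro rfl; exact hz hw
        simp [hza, hzw, hz]
    rw [Finset.sum_congr rfl fun z _ => term z, Finset.sum_sub_distrib, ← Finset.mul_sum,
      ← Finset.mul_sum, Finset.sum_sub_distrib, ← Finset.mul_sum, sum_eq_on_prefix hsm']
    simp
  have hpow : (2 : ℤ) ^ s * 2 ^ (m - s) = 2 ^ m := by
    rw [← pow_add, Nat.add_sub_cancel' hsm']
  have hle : (2 : ℤ) ^ (s + 2) ≤ 2 ^ m := pow_le_pow_right₀ (by norm_num) (by omega)
  have hpos : (0 : ℤ) < 2 ^ s := by positivity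
  rw [pow_add] at hle
  have := hbent (a, Pi.single 0 1)
  simp only [key] at this
  rcases this with h | h <;> nlinarith
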